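/- Let V be a finite-dimensional mixed lattice vector space whose topology is given by a mixed lattice norm, and suppose the specific cone V_sp is generating. Then V is a lattice with respect to the specific order ≼. -/

import Mathlib

/-- A mixed lattice vector space: a real vector space with two partial orders
(the initial order `le` and the specific order `sle`), each making it a partially
ordered vector space, such that the mixed upper and lower envelopes `up` and `down`
exist, `sle` implies `le`, and the specific cone is a mixed lattice cone. -/
structure MixedLattice (V : Type*) [AddCommGroup V] [Module ℝ V] where
  le : V → V → Prop
  sle : V → V → Prop
  le_refl : ∀ x, le x x
  le_trans : ∀ {x y z}, le x y → le y z → le x z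
  le_antisymm : ∀ {x y}, le x y → le y x → x = y
  sle_refl : ∀ x, sle x x
  sle_trans : ∀ {x y z}, sle x y → sle y z → sle x z
  sle_antisymm : ∀ {x y}, sle x y → sle y x → x = y
  le_add : ∀ {x y} (z : V), le x y → le (x + z) (y + z)
  le_smul : ∀ {a : ℝ}, 0 ≤ a → ∀ {x y}, le x y → le (a • x) (a • y)
  sle_add : ∀ {x y} (z : V), sle x y → sle (x + z) (y + z)
  sle_smul : ∀ {a : ℝ}, 0 ≤ a → ∀ {x y}, sle x y → sle (a • x) (a • y)
  /-- the mixed upper envelope `x ⌣ y` -/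
  up : V → V → V
  /-- the mixed lower envelope `x ⌢ y` -/
  down : V → V → V
  up_mem₁ : ∀ x y, sle x (up x y)
  up_mem₂ : ∀ x y, le y (up x y)
  up_min : ∀ x y w, sle x w → le y w → le (up x y) w
  down_mem₁ : ∀ x y, sle (down x y) x
  down_mem₂ : ∀ x y, le (down x y) y
  down_max : ∀ x y w, sle w x → le w y → le w (down x y)
  sle_imp_le : ∀ {x y}, sle x y → le x y
  up_cone : ∀ {x y}, sle 0 x → sle 0 y → sle 0 (up x y)
  down_cone : ∀ {x y}, sle 0 x → sle 0 y → sle 0 (down x y)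

namespace MixedLattice

variable {V : Type*} [AddCommGroup V] [Module ℝ V] (M : MixedLattice V)

/-- the specific upper part `xᵘ = 0 ⌣ x` -/
def supp (x : V) : V := M.up 0 x

/-- the specific lower part `xˡ = 0 ⌣ (-x)` -/
def slowp (x : V) : V := M.up 0 (-x)

/-- the upper part `ᵘx = x ⌣ 0` -/
def upp (x : V) : V := M.up x 0

/-- the lower part `ˡx = (-x) ⌣ 0` -/
def lowp (x : V) : V := M.up (-x) 0

/-- the symmetric generalized absolute value `s(x) = (1/2)((x⌣(−x)) + ((−x)⌣x))` -/
noncomputable def sabs (x : V) : V := (1 / 2 : ℝ) • (M.up x (-x) + M.up (-x) x)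

/-- the type 1 mixed-full hull `MF₁(A) = {y : x ≼ y ≤ z for some x, z ∈ A}` -/
def MF1 (A : Set V) : Set V := {y | ∃ x ∈ A, ∃ z ∈ A, M.sle x y ∧ M.le y z}

/-- the type 2 mixed-full hull `MF₂(A) = {y : x ≤ y ≼ z for some x, z ∈ A}` -/
def MF2 (A : Set V) : Set V := {y | ∃ x ∈ A, ∃ z ∈ A, M.le x y ∧ M.sle y z}

/-- `MS₁(A) = {y : −s(x) ≼ y ≤ s(x) for some x ∈ A}` -/
def MS1 (A : Set V) : Set V := {y | ∃ x ∈ A, M.sle (-M.sabs x) y ∧ M.le y (M.sabs x)}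

/-- `MS₂(A) = {y : −s(x) ≤ y ≼ s(x) for some x ∈ A}` -/
def MS2 (A : Set V) : Set V := {y | ∃ x ∈ A, M.le (-M.sabs x) y ∧ M.sle y (M.sabs x)}

/-- a set is symmetric-solid if `x ∈ A` and `s(y) ≤ s(x)` imply `y ∈ A` -/
def SymmSolid (A : Set V) : Prop := ∀ x ∈ A, ∀ y, M.le (M.sabs y) (M.sabs x) → y ∈ A

/-- a set is (≤)-full if `x, y ∈ S` and `y ≤ z ≤ x` imply `z ∈ S` -/
def LeFull (S : Set V) : Prop := ∀ x ∈ S, ∀ y ∈ S, ∀ z, M.le y z → M.le z x → z ∈ S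

/-- a set is (≼)-full if `x, y ∈ S` and `y ≼ z ≼ x` imply `z ∈ S` -/
def SleFull (S : Set V) : Prop := ∀ x ∈ S, ∀ y ∈ S, ∀ z, M.sle y z → M.sle z x → z ∈ S

/-- a linear subspace, as a set -/
def IsSubspace (S : Set V) : Prop :=
  (0 : V) ∈ S ∧ (∀ x ∈ S, ∀ y ∈ S, x + y ∈ S) ∧ ∀ (a : ℝ), ∀ x ∈ S, a • x ∈ S

/-- a mixed lattice subspace -/
def IsMLSubspace (S : Set V) : Prop :=
  IsSubspace S ∧ ∀ x ∈ S, ∀ y ∈ S, M.up x y ∈ S ∧ M.down x y ∈ S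

section Topology

variable [TopologicalSpace V]

/-- uniform continuity of a map `V → V` with respect to a vector topology -/
def UnifCont (f : V → V) : Prop :=
  ∀ W ∈ nhds (0 : V), ∃ U ∈ nhds (0 : V), ∀ x y : V, x - y ∈ U → f x - f y ∈ W

/-- uniform continuity of a map `V × V → V` with respect to a vector topology -/
def UnifCont2 (g : V → V → V) : Prop :=
  ∀ W ∈ nhds (0 : V), ∃ U ∈ nhds (0 : V),
    ∀ x x' y y' : V, x - x' ∈ U → y - y' ∈ U → g x y - g x' y' ∈ W

/-- the topology is locally mixed-full: every neighborhood of zero contains a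
type 1 mixed-full neighborhood of zero -/
def LocallyMixedFull : Prop :=
  ∀ U ∈ nhds (0 : V), ∃ W ∈ nhds (0 : V), W ⊆ U ∧ M.MF1 W = W

/-- the topology has a neighborhood base at zero of symmetric-solid sets -/
def LocallySymmSolid : Prop :=
  ∀ U ∈ nhds (0 : V), ∃ W ∈ nhds (0 : V), W ⊆ U ∧ M.SymmSolid W

/-- the topology has a neighborhood base at zero of (≤)-full sets -/
def LocallyLeFull : Prop :=
  ∀ U ∈ nhds (0 : V), ∃ W ∈ nhds (0 : V), W ⊆ U ∧ M.LeFull W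

/-- the mixed lattice operations are continuous at zero -/
def ContAtZero : Prop :=
  ContinuousAt (fun p : V × V => M.up p.1 p.2) ((0 : V), (0 : V)) ∧
  ContinuousAt (fun p : V × V => M.down p.1 p.2) ((0 : V), (0 : V))

end Topology

end MixedLattice

namespace MixedLattice

section Algebra

variable {V : Type*} [AddCommGroup V] [Module ℝ V] (M : MixedLattice V)

theorem le_iff_sub_nonneg {x y : V} : M.le x y ↔ M.le 0 (y - x) :=
  ⟨fun h => by simpa [sub_eq_add_neg] using M.le_add (-x) h,
    fun h => by simpa using M.le_add x h⟩

theorem sle_iff_sub_nonneg {x y : V} : M.sle x y ↔ M.sle 0 (y - x) :=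
  ⟨fun h => by simpa [sub_eq_add_neg] using M.sle_add (-x) h,
    fun h => by simpa using M.sle_add x h⟩

theorem le_add_nonneg {x y : V} (hx : M.le 0 x) (hy : M.le 0 y) : M.le 0 (x + y) :=
  M.le_trans hy (by simpa using M.le_add y hx)

theorem sle_add_nonneg {x y : V} (hx : M.sle 0 x) (hy : M.sle 0 y) : M.sle 0 (x + y) :=
  M.sle_trans hy (by simpa using M.sle_add y hx)

theorem le_smul_nonneg {a : ℝ} (ha : 0 ≤ a) {x : V} (hx : M.le 0 x) : M.le 0 (a • x) := by
  simpa using M.le_smul ha hx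

theorem sle_smul_nonneg {a : ℝ} (ha : 0 ≤ a) {x : V} (hx : M.sle 0 x) : M.sle 0 (a • x) := by
  simpa using M.sle_smul ha hx

theorem sle_supp (x : V) : M.sle 0 (M.supp x) := M.up_mem₁ 0 x

theorem le_supp (x : V) : M.le x (M.supp x) := M.up_mem₂ 0 x

theorem supp_le {x w : V} (hw : M.sle 0 w) (hx : M.le x w) : M.le (M.supp x) w :=
  M.up_min 0 x w hw hx

theorem supp_mono {x y : V} (h : M.le x y) : M.le (M.supp x) (M.supp y) :=
  M.supp_le (M.sle_supp y) (M.le_trans h (M.le_supp y))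

theorem sle_zero_iff_supp_eq {x : V} : M.sle 0 x ↔ M.supp x = x :=
  ⟨fun h => M.le_antisymm (M.supp_le h (M.le_refl x)) (M.le_supp x),
    fun h => h ▸ M.sle_supp x⟩

theorem le_zero_iff_supp_neg_eq {x : V} : M.le 0 x ↔ M.supp (-x) = 0 := by
  have key : M.le 0 x ↔ M.le (-x) 0 := by
    rw [M.le_iff_sub_nonneg, M.le_iff_sub_nonneg (x := -x)]
    simp
  rw [key]
  exact ⟨fun h => M.le_antisymm (M.supp_le (M.sle_refl 0) h) (M.sle_imp_le (M.sle_supp _)),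
    fun h => h ▸ M.le_supp (-x)⟩

theorem supp_sub_supp_le (x y : V) : M.le (M.supp x - M.supp y) (M.supp (x - y)) := by
  have h := M.supp_le (x := x) (M.sle_add_nonneg (M.sle_supp (x - y)) (M.sle_supp y)) (by
    rw [M.le_iff_sub_nonneg]
    convert M.le_add_nonneg (M.le_iff_sub_nonneg.1 (M.le_supp (x - y)))
      (M.le_iff_sub_nonneg.1 (M.le_supp y)) using 1
    abel)
  simpa [sub_eq_add_neg] using M.le_add (-M.supp y) h

theorem up_self_neg (x : V) : M.up x (-x) = x + (2 : ℝ) • M.supp (-x) := by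
  apply M.le_antisymm
  · apply M.up_min
    · rw [M.sle_iff_sub_nonneg, add_sub_cancel_left]
      exact M.sle_smul_nonneg zero_le_two (M.sle_supp _)
    · rw [M.le_iff_sub_nonneg]
      convert M.le_smul_nonneg zero_le_two (M.le_iff_sub_nonneg.1 (M.le_supp (-x))) using 1
      module
  · have h := M.supp_le (x := -x) (w := (1 / 2 : ℝ) • (M.up x (-x) - x))
      (M.sle_smul_nonneg (by norm_num) (M.sle_iff_sub_nonneg.1 (M.up_mem₁ x (-x)))) (by
        rw [M.le_iff_sub_nonneg]
        convert M.le_smul_nonneg (a := 1 / 2) (by norm_num)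
          (M.le_iff_sub_nonneg.1 (M.up_mem₂ x (-x))) using 1
        module)
    rw [M.le_iff_sub_nonneg] at h ⊢
    convert M.le_smul_nonneg zero_le_two h using 1
    module

theorem sabs_eq_supp_add (x : V) : M.sabs x = M.supp x + M.supp (-x) := by
  have h := M.up_self_neg (-x)
  rw [neg_neg] at h
  rw [sabs, h, M.up_self_neg x]
  module

theorem sle_sabs (x : V) : M.sle 0 (M.sabs x) := by
  rw [sabs_eq_supp_add]
  exact M.sle_add_nonneg (M.sle_supp _) (M.sle_supp _)

theorem sabs_of_nonneg {x : V} (hx : M.le 0 x) : M.sabs x = M.supp x := by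
  rw [sabs_eq_supp_add, M.le_zero_iff_supp_neg_eq.1 hx, add_zero]

theorem sabs_of_sle {x : V} (hx : M.sle 0 x) : M.sabs x = x := by
  rw [M.sabs_of_nonneg (M.sle_imp_le hx), M.sle_zero_iff_supp_eq.1 hx]

theorem down_sub_le (a b z : V) : M.le (M.down (a - z) (b - z)) (M.down a b - z) := by
  have h := M.down_max a b (M.down (a - z) (b - z) + z)
    (by simpa using M.sle_add z (M.down_mem₁ (a - z) (b - z)))
    (by simpa using M.le_add z (M.down_mem₂ (a - z) (b - z)))
  simpa [sub_eq_add_neg] using M.le_add (-z) h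

theorem down_sub_down (a b z : V) : M.down (a - z) (b - z) = M.down a b - z := by
  apply M.le_antisymm (M.down_sub_le a b z)
  simpa [← sub_eq_add_neg] using M.le_add (-z) (M.down_sub_le (a - z) (b - z) (-z))

theorem sle_down {x a b : V} (ha : M.sle x a) (hb : M.sle x b) : M.sle x (M.down a b) := by
  rw [M.sle_iff_sub_nonneg] at ha hb ⊢
  rw [← M.down_sub_down]
  exact M.down_cone ha hb

/-- A common specific upper bound of `x` and `y` that is least for the initial order among all
such bounds is also least for the specific order. -/
theorem sle_of_forall_le {x y z w : V} (hxz : M.sle x z) (hyz : M.sle y z)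
    (hz : ∀ v, M.sle x v → M.sle y v → M.le z v) (hxw : M.sle x w) (hyw : M.sle y w) :
    M.sle z w := by
  have h : M.down w z = z := M.le_antisymm (M.down_mem₂ w z)
    (hz _ (M.sle_down hxw hxz) (M.sle_down hyw hyz))
  exact h ▸ M.down_mem₁ w z

theorem exists_sle_sle (hgen : ∀ v : V, ∃ a b : V, M.sle 0 a ∧ M.sle 0 b ∧ v = a - b)
    (x y : V) : ∃ w, M.sle x w ∧ M.sle y w := by
  obtain ⟨a, b, ha, hb, rfl⟩ := hgen x
  obtain ⟨c, d, hc, hd, rfl⟩ := hgen y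
  refine ⟨a + c, ?_, ?_⟩ <;> rw [M.sle_iff_sub_nonneg]
  · convert M.sle_add_nonneg hc hb using 1
    abel
  · convert M.sle_add_nonneg ha hd using 1
    abel

end Algebra

section Norm

variable {V : Type*} [NormedAddCommGroup V] [NormedSpace ℝ V] {M : MixedLattice V}

theorem norm_le_of_nonneg_of_le (hml : ∀ x y : V, M.le (M.sabs x) (M.sabs y) → ‖x‖ ≤ ‖y‖)
    {x y : V} (hx : M.le 0 x) (hxy : M.le x y) : ‖x‖ ≤ ‖y‖ := by
  apply hml
  rw [M.sabs_of_nonneg hx, M.sabs_of_nonneg (M.le_trans hx hxy)]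
  exact M.supp_mono hxy

theorem norm_sabs_le (hml : ∀ x y : V, M.le (M.sabs x) (M.sabs y) → ‖x‖ ≤ ‖y‖) (x : V) :
    ‖M.sabs x‖ ≤ ‖x‖ := by
  apply hml
  rw [M.sabs_of_sle (M.sle_sabs x)]
  exact M.le_refl _

theorem norm_supp_sub_supp_le (hml : ∀ x y : V, M.le (M.sabs x) (M.sabs y) → ‖x‖ ≤ ‖y‖)
    (x y : V) : ‖M.supp x - M.supp y‖ ≤ 2 * ‖x - y‖ := by
  have hsum : M.sabs (x - y) = M.supp (x - y) + M.supp (y - x) := by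
    rw [sabs_eq_supp_add, neg_sub]
  have hs := norm_sabs_le hml (x - y)
  have hb : ‖M.supp (y - x)‖ ≤ ‖x - y‖ := by
    refine (norm_le_of_nonneg_of_le hml (M.sle_imp_le (M.sle_supp _)) ?_).trans hs
    rw [hsum, M.le_iff_sub_nonneg, add_sub_cancel_right]
    exact M.sle_imp_le (M.sle_supp _)
  have hd : ‖M.supp x - M.supp y + M.supp (y - x)‖ ≤ ‖x - y‖ := by
    refine (norm_le_of_nonneg_of_le hml ?_ ?_).trans hs
    · convert M.le_iff_sub_nonneg.1 (M.supp_sub_supp_le y x) using 1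
      abel
    · rw [hsum]
      exact M.le_add _ (M.supp_sub_supp_le x y)
  calc ‖M.supp x - M.supp y‖
      = ‖(M.supp x - M.supp y + M.supp (y - x)) - M.supp (y - x)‖ := by rw [add_sub_cancel_right]
    _ ≤ 2 * ‖x - y‖ := by
      linarith [norm_sub_le (M.supp x - M.supp y + M.supp (y - x)) (M.supp (y - x))]

theorem continuous_supp (hml : ∀ x y : V, M.le (M.sabs x) (M.sabs y) → ‖x‖ ≤ ‖y‖) :
    Continuous M.supp :=
  (LipschitzWith.of_dist_le_mul (K := 2) fun x y => by
    simpa [dist_eq_norm] using norm_supp_sub_supp_le hml x y).continuous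

theorem isClosed_sle (hml : ∀ x y : V, M.le (M.sabs x) (M.sabs y) → ‖x‖ ≤ ‖y‖) (x : V) :
    IsClosed {t | M.sle x t} := by
  have hc := continuous_supp hml
  simp_rw [fun t => M.sle_iff_sub_nonneg (x := x) (y := t), M.sle_zero_iff_supp_eq]
  exact isClosed_eq (by fun_prop) (by fun_prop)

theorem isClosed_ge (hml : ∀ x y : V, M.le (M.sabs x) (M.sabs y) → ‖x‖ ≤ ‖y‖) (w : V) :
    IsClosed {t | M.le t w} := by
  have hc := continuous_supp hml
  simp_rw [fun t => M.le_iff_sub_nonneg (x := t) (y := w), M.le_zero_iff_supp_neg_eq]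
  exact isClosed_eq (by fun_prop) (by fun_prop)

theorem exists_specific_sup [FiniteDimensional ℝ V]
    (hml : ∀ x y : V, M.le (M.sabs x) (M.sabs y) → ‖x‖ ≤ ‖y‖)
    (hgen : ∀ v : V, ∃ a b : V, M.sle 0 a ∧ M.sle 0 b ∧ v = a - b) (x y : V) :
    ∃ z : V, M.sle x z ∧ M.sle y z ∧ ∀ w : V, M.sle x w → M.sle y w → M.sle z w := by
  have : ProperSpace V := FiniteDimensional.proper ℝ V
  let K : {w : V // M.sle x w ∧ M.sle y w} → Set V := fun w =>
    {t | M.sle x t} ∩ {t | M.sle y t} ∩ {t | M.le t w}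
  have hne : Nonempty {w : V // M.sle x w ∧ M.sle y w} := by
    obtain ⟨w, hw⟩ := M.exists_sle_sle hgen x y
    exact ⟨⟨w, hw⟩⟩
  have hclosed : ∀ w, IsClosed (K w) := fun w =>
    ((isClosed_sle hml x).inter (isClosed_sle hml y)).inter (isClosed_ge hml w)
  have hcompact : ∀ w, IsCompact (K w) := fun w => by
    refine (isCompact_closedBall x ‖(w : V) - x‖).of_isClosed_subset (hclosed w) ?_
    rintro t ⟨⟨hxt, -⟩, htw⟩
    rw [mem_closedBall_iff_norm]
    refine norm_le_of_nonneg_of_le hml (M.sle_imp_le (M.sle_iff_sub_nonneg.1 hxt)) ?_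
    simpa [sub_eq_add_neg] using M.le_add (-x) htw
  have hdir : Directed (fun s t => s ⊇ t) K := fun v w =>
    ⟨⟨M.down v w, M.sle_down v.2.1 w.2.1, M.sle_down v.2.2 w.2.2⟩,
      fun _ ht => ⟨ht.1, M.le_trans ht.2 (M.sle_imp_le (M.down_mem₁ _ _))⟩,
      fun _ ht => ⟨ht.1, M.le_trans ht.2 (M.down_mem₂ _ _)⟩⟩
  obtain ⟨z, hz⟩ := IsCompact.nonempty_iInter_of_directed_nonempty_isCompact_isClosed K hdir
    (fun w => ⟨w, ⟨w.2.1, w.2.2⟩, M.le_refl _⟩) hcompact hclosed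
  rw [Set.mem_iInter] at hz
  obtain ⟨⟨hxz, hyz⟩, -⟩ := hz hne.some
  exact ⟨z, hxz, hyz, fun w hxw hyw =>
    M.sle_of_forall_le hxz hyz (fun v hxv hyv => (hz ⟨v, hxv, hyv⟩).2) hxw hyw⟩

end Norm

end MixedLattice

/-- a finite-dimensional normed mixed lattice space (its topology given
by a mixed lattice norm) whose specific cone is generating is a lattice with respect to
the specific order. -/
theorem stmt_19 {V : Type*} [AddCommGroup V] [Module ℝ V] (M : MixedLattice V)
    [FiniteDimensional ℝ V]
    (p : Seminorm ℝ V) (hnorm : ∀ x : V, p x = 0 → x = 0)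
    (hml : ∀ x y : V, M.le (M.sabs x) (M.sabs y) → p x ≤ p y)
    (hgen : ∀ v : V, ∃ a b : V, M.sle 0 a ∧ M.sle 0 b ∧ v = a - b) :
    ∀ x y : V, ∃ z : V, M.sle x z ∧ M.sle y z ∧
      ∀ w : V, M.sle x w → M.sle y w → M.sle z w := by
  let : NormedAddCommGroup V := AddGroupNorm.toNormedAddCommGroup
    { p.toAddGroupSeminorm with eq_zero_of_map_eq_zero' := hnorm }
  let : NormedSpace ℝ V := ⟨fun a x => (map_smul_eq_mul p a x).le⟩
  exact MixedLattice.exists_specific_sup hml hgen
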